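/- There exist universal constants c > 0 and C ≥ 1 such that for every nonempty finite set X, all distributions p, q on X with d_TV(p,q) > 0, every ε₀ ∈ (0, d_TV(p,q)/4], every ε with ε₀ ≤ ε ≤ ε₀ + c·ε₀², and every model A ∈ {TV, Hub, Sub}: n*_A(p,q,ε₀) ≤ n*_A(p,q,ε) ≤ C·n*_A(p,q,ε₀). -/

import Mathlib

open scoped Classical ENNReal
open Finset

noncomputable section

/-- A probability distribution on a finite set. -/
def IsDist {X : Type*} [Fintype X] (p : X → ℝ) : Prop :=
  (∀ x, 0 ≤ p x) ∧ ∑ x, p x = 1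

/-- Total variation distance. -/
def dTV {X : Type*} [Fintype X] (p q : X → ℝ) : ℝ :=
  (1 / 2) * ∑ x, |p x - q x|

/-- Squared Hellinger divergence (also for unnormalized nonnegative vectors). -/
def hellSq {X : Type*} [Fintype X] (p q : X → ℝ) : ℝ :=
  ∑ x, (Real.sqrt (p x) - Real.sqrt (q x)) ^ 2

/-- ε-Huber uncertainty set. -/
def PHub {X : Type*} [Fintype X] (p : X → ℝ) (ε : ℝ) : Set (X → ℝ) :=
  {p' | IsDist p' ∧ ∀ x, (1 - ε) * p x ≤ p' x}

/-- ε-TV uncertainty set. -/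
def PTV {X : Type*} [Fintype X] (p : X → ℝ) (ε : ℝ) : Set (X → ℝ) :=
  {p' | IsDist p' ∧ dTV p' p ≤ ε}

/-- ε-subtractive uncertainty set. -/
def PSub {X : Type*} [Fintype X] (p : X → ℝ) (ε : ℝ) : Set (X → ℝ) :=
  {p' | IsDist p' ∧ ∀ x, p' x ≤ (1 + ε) * p x}

/-- Sum of worst-case type-I and type-II errors of a randomized test `φ` on `n`
i.i.d. samples, for composite hypotheses `Pcal` vs `Qcal`. -/
def errSum {X : Type*} [Fintype X] (Pcal Qcal : Set (X → ℝ)) (n : ℕ)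
    (φ : (Fin n → X) → ℝ) : ℝ :=
  (⨆ P : Pcal, ∑ x : Fin n → X, (∏ i, (P : X → ℝ) (x i)) * φ x) +
  (⨆ Q : Qcal, ∑ x : Fin n → X, (∏ i, (Q : X → ℝ) (x i)) * (1 - φ x))

/-- Minimax `n`-sample error for testing `Pcal` against `Qcal`. -/
def eStar {X : Type*} [Fintype X] (Pcal Qcal : Set (X → ℝ)) (n : ℕ) : ℝ :=
  ⨅ φ : {φ : (Fin n → X) → ℝ // ∀ x, 0 ≤ φ x ∧ φ x ≤ 1}, errSum Pcal Qcal n φ.1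

/-- Sample complexity: the least `n` with minimax error at most `1/10` (`⊤` if none). -/
def nStar {X : Type*} [Fintype X] (Pcal Qcal : Set (X → ℝ)) : ℝ≥0∞ :=
  sInf {N : ℝ≥0∞ | ∃ n : ℕ, N = (n : ℝ≥0∞) ∧ eStar Pcal Qcal n ≤ 1 / 10}

/-- Expectation of `f` under `n` i.i.d. samples from `P`. -/
def iidExp {X : Type*} [Fintype X] (P : X → ℝ) (n : ℕ) (f : (Fin n → X) → ℝ) : ℝ :=
  ∑ x : Fin n → X, (∏ i, P (x i)) * f x

section IidExp

variable {X : Type*} [Fintype X] {P : X → ℝ} {n : ℕ}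

lemma iidExp_succ (P : X → ℝ) (n : ℕ) (f : (Fin (n + 1) → X) → ℝ) :
    iidExp P (n + 1) f = ∑ a, P a * iidExp P n (fun x => f (Fin.cons a x)) := by
  unfold iidExp
  rw [← (Fin.consEquiv (fun _ : Fin (n + 1) => X)).sum_comp, Fintype.sum_prod_type]
  refine Finset.sum_congr rfl fun a _ => ?_
  rw [Finset.mul_sum]
  refine Finset.sum_congr rfl fun x _ => ?_
  simp [Fin.consEquiv, Fin.prod_univ_succ, mul_assoc]

lemma iidExp_append (P : X → ℝ) (m n : ℕ) (f : (Fin m → X) → ℝ) (g : (Fin n → X) → ℝ) :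
    iidExp P (m + n) (fun x => f (fun i => x (Fin.castAdd n i)) * g (fun i => x (Fin.natAdd m i)))
      = iidExp P m f * iidExp P n g := by
  unfold iidExp
  rw [← (Fin.appendEquiv m n).sum_comp, Fintype.sum_prod_type, Finset.sum_mul_sum]
  refine Finset.sum_congr rfl fun x _ => Finset.sum_congr rfl fun y _ => ?_
  simp only [Fin.appendEquiv, Equiv.coe_fn_mk, Fin.prod_univ_add, Fin.append_left,
    Fin.append_right]
  ring

lemma iidExp_add (P : X → ℝ) (n : ℕ) (f g : (Fin n → X) → ℝ) :
    iidExp P n (fun x => f x + g x) = iidExp P n f + iidExp P n g := by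
  simp only [iidExp, mul_add, Finset.sum_add_distrib]

lemma iidExp_sub (P : X → ℝ) (n : ℕ) (f g : (Fin n → X) → ℝ) :
    iidExp P n (fun x => f x - g x) = iidExp P n f - iidExp P n g := by
  simp only [iidExp, mul_sub, Finset.sum_sub_distrib]

lemma iidExp_const_mul (P : X → ℝ) (n : ℕ) (c : ℝ) (f : (Fin n → X) → ℝ) :
    iidExp P n (fun x => c * f x) = c * iidExp P n f := by
  simp only [iidExp, Finset.mul_sum]
  exact Finset.sum_congr rfl fun x _ => by ring

lemma iidExp_mono (hP : IsDist P) {f g : (Fin n → X) → ℝ} (h : ∀ x, f x ≤ g x) :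
    iidExp P n f ≤ iidExp P n g :=
  Finset.sum_le_sum fun x _ =>
    mul_le_mul_of_nonneg_left (h x) (Finset.prod_nonneg fun _ _ => hP.1 _)

lemma iidExp_const (hP : IsDist P) (n : ℕ) (c : ℝ) : iidExp P n (fun _ => c) = c := by
  induction n with
  | zero => simp [iidExp]
  | succ n ih => rw [iidExp_succ]; simp only [ih, ← Finset.sum_mul, hP.2, one_mul]

lemma iidExp_nonneg (hP : IsDist P) {f : (Fin n → X) → ℝ} (h : ∀ x, 0 ≤ f x) :
    0 ≤ iidExp P n f :=
  (iidExp_const hP n 0).symm.trans_le (iidExp_mono hP h)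

lemma iidExp_le_one (hP : IsDist P) {f : (Fin n → X) → ℝ} (h : ∀ x, f x ≤ 1) :
    iidExp P n f ≤ 1 :=
  (iidExp_mono hP h).trans_eq (iidExp_const hP n 1)

lemma iidExp_one_sub (hP : IsDist P) (f : (Fin n → X) → ℝ) :
    iidExp P n (fun x => 1 - f x) = 1 - iidExp P n f := by
  rw [iidExp_sub, iidExp_const hP]

lemma iidExp_sum_eq_zero (hP : IsDist P) {f : X → ℝ} (hf : ∑ a, P a * f a = 0) (n : ℕ) :
    iidExp P n (fun x => ∑ i, f (x i)) = 0 := by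
  induction n with
  | zero => simp [iidExp]
  | succ n ih =>
    rw [iidExp_succ]
    simp only [Fin.sum_univ_succ, Fin.cons_zero, Fin.cons_succ, iidExp_add, iidExp_const hP, ih,
      add_zero, hf]

lemma iidExp_sum_sq (hP : IsDist P) {f : X → ℝ} (hf : ∑ a, P a * f a = 0) (n : ℕ) :
    iidExp P n (fun x => (∑ i, f (x i)) ^ 2) = n * ∑ a, P a * f a ^ 2 := by
  induction n with
  | zero => simp [iidExp]
  | succ n ih =>
    rw [iidExp_succ]
    simp only [Fin.sum_univ_succ, Fin.cons_zero, Fin.cons_succ, add_sq, iidExp_add,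
      iidExp_const hP, iidExp_const_mul, ih, iidExp_sum_eq_zero hP hf, mul_zero, add_zero,
      mul_add, Finset.sum_add_distrib, ← Finset.sum_mul, hP.2]
    push_cast
    ring

end IidExp

section Majority

variable {X : Type*}

/-- The randomized majority vote of a test over three independent blocks of samples. -/
def majorityTest {n : ℕ} (φ : (Fin n → X) → ℝ) (x : Fin (n + n + n) → X) : ℝ :=
  let a := φ fun i => x (Fin.castAdd n (Fin.castAdd n i))
  let b := φ fun i => x (Fin.castAdd n (Fin.natAdd n i))
  let c := φ fun i => x (Fin.natAdd (n + n) i)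
  a * b + a * c + b * c - 2 * (a * b * c)

lemma majorityTest_mem {n : ℕ} {φ : (Fin n → X) → ℝ} (hφ : ∀ x, 0 ≤ φ x ∧ φ x ≤ 1)
    (x : Fin (n + n + n) → X) : 0 ≤ majorityTest φ x ∧ majorityTest φ x ≤ 1 := by
  unfold majorityTest
  extract_lets a b c
  obtain ⟨ha0, ha1⟩ : 0 ≤ a ∧ a ≤ 1 := hφ _
  obtain ⟨hb0, hb1⟩ : 0 ≤ b ∧ b ≤ 1 := hφ _
  obtain ⟨hc0, hc1⟩ : 0 ≤ c ∧ c ≤ 1 := hφ _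
  have ha := sub_nonneg.2 ha1
  have hb := sub_nonneg.2 hb1
  have hc := sub_nonneg.2 hc1
  constructor
  · have h1 := mul_nonneg (mul_nonneg ha0 hb0) hc
    have h2 := mul_nonneg (mul_nonneg ha0 hc0) hb
    have h3 := mul_nonneg hb0 hc0
    linarith
  · have h1 := mul_nonneg (mul_nonneg ha hb) hc0
    have h2 := mul_nonneg (mul_nonneg ha hc) hb0
    have h3 := mul_nonneg hb hc
    linarith

lemma majorityTest_one_sub {n : ℕ} (φ : (Fin n → X) → ℝ) (x : Fin (n + n + n) → X) :
    1 - majorityTest φ x = majorityTest (fun y => 1 - φ y) x := by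
  simp only [majorityTest]; ring

end Majority

section Tests

variable {X : Type*} [Fintype X]

lemma sum_mul_sub_le_dTV {P Q : X → ℝ} (hP : IsDist P) (hQ : IsDist Q) {g : X → ℝ}
    (h0 : ∀ x, 0 ≤ g x) (h1 : ∀ x, g x ≤ 1) :
    ∑ x, P x * g x - ∑ x, Q x * g x ≤ dTV P Q := by
  have key : ∑ x, P x * g x - ∑ x, Q x * g x = ∑ x, (P x - Q x) * (g x - 1 / 2) := by
    have : ∑ x, (P x - Q x) * (g x - 1 / 2)
        = (∑ x, P x * g x - ∑ x, Q x * g x) - (∑ x, P x - ∑ x, Q x) * (1 / 2) := by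
      rw [← Finset.sum_sub_distrib, ← Finset.sum_sub_distrib, Finset.sum_mul,
        ← Finset.sum_sub_distrib]
      exact Finset.sum_congr rfl fun x _ => by ring
    rw [this, hP.2, hQ.2]; ring
  rw [key, dTV, Finset.mul_sum]
  refine Finset.sum_le_sum fun x _ => (le_abs_self _).trans ?_
  rw [abs_mul, mul_comm]
  refine mul_le_mul_of_nonneg_right ?_ (abs_nonneg _)
  rw [abs_le]
  constructor <;> linarith [h0 x, h1 x]

lemma dTV_eq_sum_indicator {p q : X → ℝ} (hp : IsDist p) (hq : IsDist q) :
    dTV p q = ∑ x, p x * (if q x ≤ p x then 1 else 0) - ∑ x, q x * (if q x ≤ p x then 1 else 0) := by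
  have h : ∀ x, (1 / 2) * |p x - q x|
      = p x * (if q x ≤ p x then 1 else 0) - q x * (if q x ≤ p x then 1 else 0)
        - (p x - q x) * (1 / 2) := by
    intro x
    split_ifs with hx
    · rw [abs_of_nonneg (by linarith)]; ring
    · rw [abs_of_neg (by linarith)]; ring
  rw [dTV, Finset.mul_sum, Finset.sum_congr rfl fun x _ => h x, Finset.sum_sub_distrib,
    ← Finset.sum_mul, Finset.sum_sub_distrib, Finset.sum_sub_distrib, hp.2, hq.2]
  ring

lemma dTV_comm (p q : X → ℝ) : dTV p q = dTV q p := by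
  simp only [dTV, abs_sub_comm]

lemma dTV_le_one {p q : X → ℝ} (hp : IsDist p) (hq : IsDist q) : dTV p q ≤ 1 := by
  have : ∑ x, |p x - q x| ≤ ∑ x, (p x + q x) := Finset.sum_le_sum fun x _ => by
    rw [abs_le]; constructor <;> linarith [hp.1 x, hq.1 x]
  rw [Finset.sum_add_distrib, hp.2, hq.2] at this
  unfold dTV; linarith

/-- Subadditivity of total variation over the `n` samples. -/
lemma iidExp_le_add_dTV {P Q : X → ℝ} (hP : IsDist P) (hQ : IsDist Q) (n : ℕ)
    {φ : (Fin n → X) → ℝ} (h0 : ∀ x, 0 ≤ φ x) (h1 : ∀ x, φ x ≤ 1) :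
    iidExp P n φ ≤ iidExp Q n φ + n * dTV P Q := by
  induction n with
  | zero => simp [iidExp]
  | succ n ih =>
    rw [iidExp_succ, iidExp_succ]
    have hstep : ∑ a, P a * iidExp P n (fun x => φ (Fin.cons a x))
        ≤ ∑ a, P a * (iidExp Q n (fun x => φ (Fin.cons a x)) + n * dTV P Q) :=
      Finset.sum_le_sum fun a _ => mul_le_mul_of_nonneg_left
        (ih (fun x => h0 _) (fun x => h1 _)) (hP.1 a)
    have htv := sum_mul_sub_le_dTV hP hQ (g := fun a => iidExp Q n (fun x => φ (Fin.cons a x)))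
      (fun a => iidExp_nonneg hQ fun x => h0 _) (fun a => iidExp_le_one hQ fun x => h1 _)
    simp only [mul_add, Finset.sum_add_distrib, ← Finset.sum_mul, hP.2, one_mul] at hstep
    push_cast
    linarith

/-- Chebyshev's inequality for `[0,1]`-valued samples, in terms of a test dominated by the event
that the sum deviates from its mean by at least `n * s`. -/
lemma iidExp_le_of_deviation {P : X → ℝ} (hP : IsDist P) {g : X → ℝ} (h0 : ∀ x, 0 ≤ g x)
    (h1 : ∀ x, g x ≤ 1) {n : ℕ} (hn : 0 < n) {s : ℝ} (hs : 0 < s) {φ : (Fin n → X) → ℝ}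
    (hφ1 : ∀ x, φ x ≤ 1)
    (hφ : ∀ x, |∑ i, g (x i) - n * ∑ a, P a * g a| < n * s → φ x ≤ 0) :
    iidExp P n φ ≤ 1 / (n * s ^ 2) := by
  set μ := ∑ a, P a * g a with hμ
  have hn' : (0 : ℝ) < n := by exact_mod_cast hn
  have hμ0 : 0 ≤ μ := Finset.sum_nonneg fun a _ => mul_nonneg (hP.1 a) (h0 a)
  have hμ1 : μ ≤ 1 := by
    rw [← hP.2]
    exact Finset.sum_le_sum fun a _ => mul_le_of_le_one_right (hP.1 a) (h1 a)
  have hcent : ∑ a, P a * (g a - μ) = 0 := by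
    simp only [mul_sub, Finset.sum_sub_distrib, ← Finset.sum_mul, hP.2]; rw [← hμ]; ring
  have hsum : ∀ x : Fin n → X, ∑ i, (g (x i) - μ) = ∑ i, g (x i) - n * μ := fun x => by simp
  have hpt : ∀ x, φ x ≤ 1 / (n * s) ^ 2 * (∑ i, (g (x i) - μ)) ^ 2 := by
    intro x
    rw [hsum]
    by_cases hx : |∑ i, g (x i) - n * μ| < n * s
    · exact (hφ x hx).trans (by positivity)
    · refine (hφ1 x).trans ?_
      have hsq : (n * s) ^ 2 ≤ (∑ i, g (x i) - n * μ) ^ 2 := by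
        rw [← sq_abs (∑ i, g (x i) - n * μ)]
        exact pow_le_pow_left₀ (by positivity) (not_lt.mp hx) 2
      rw [one_div, ← div_eq_inv_mul, le_div_iff₀ (by positivity), one_mul]
      exact hsq
  have hvar : ∑ a, P a * (g a - μ) ^ 2 ≤ 1 := by
    rw [← hP.2]
    refine Finset.sum_le_sum fun a _ => mul_le_of_le_one_right (hP.1 a) ?_
    rw [sq_le_one_iff_abs_le_one, abs_le]
    constructor <;> linarith [h0 a, h1 a]
  calc iidExp P n φ
      ≤ 1 / (n * s) ^ 2 * (n * ∑ a, P a * (g a - μ) ^ 2) := by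
        rw [← iidExp_sum_sq hP hcent, ← iidExp_const_mul]
        exact iidExp_mono hP hpt
    _ ≤ 1 / (n * s) ^ 2 * (n * 1) := by gcongr
    _ = 1 / (n * s ^ 2) := by field_simp

/-- The threshold test on the Scheffé set, robust to total variation contamination. -/
lemma exists_robust_test {p q : X → ℝ} (hp : IsDist p) (hq : IsDist q) (hpq : 0 < dTV p q)
    {ε : ℝ} (hε : ε ≤ dTV p q / 4) {n : ℕ} (hn : 320 / dTV p q ^ 2 ≤ n) :
    ∃ φ : (Fin n → X) → ℝ, (∀ x, 0 ≤ φ x ∧ φ x ≤ 1) ∧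
      (∀ P ∈ PTV p ε, iidExp P n φ ≤ 1 / 20) ∧
      (∀ Q ∈ PTV q ε, iidExp Q n (fun x => 1 - φ x) ≤ 1 / 20) := by
  set δ := dTV p q with hδ
  set g : X → ℝ := fun x => if q x ≤ p x then 1 else 0 with hg
  have hg0 : ∀ x, 0 ≤ g x := fun x => by simp only [hg]; split_ifs <;> norm_num
  have hg1 : ∀ x, g x ≤ 1 := fun x => by simp only [hg]; split_ifs <;> norm_num
  have hgap : δ = ∑ x, p x * g x - ∑ x, q x * g x := dTV_eq_sum_indicator hp hq
  set t := (∑ x, p x * g x + ∑ x, q x * g x) / 2 with ht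
  have hn0 : (0 : ℝ) < n := lt_of_lt_of_le (by positivity) hn
  have hbound : 1 / (n * (δ / 4) ^ 2) ≤ (1 : ℝ) / 20 := by
    rw [div_le_iff₀ (by positivity)] at hn
    rw [div_le_div_iff₀ (by positivity) (by norm_num)]
    linarith
  refine ⟨fun x => if ∑ i, g (x i) < n * t then 1 else 0, fun x => ?_, ?_, ?_⟩
  · dsimp only; split_ifs <;> norm_num
  · intro P hP
    have hPg := sum_mul_sub_le_dTV hp hP.1 hg0 hg1
    rw [dTV_comm] at hPg
    have hPε := hP.2
    refine (iidExp_le_of_deviation hP.1 hg0 hg1 (by exact_mod_cast hn0) (s := δ / 4)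
      (by positivity) (fun x => ?_) (fun x hx => ?_)).trans hbound
    · split_ifs <;> norm_num
    · rw [if_neg]
      have := (abs_lt.mp hx).1
      have h2 : n * t ≤ n * (∑ a, P a * g a - δ / 4) :=
        mul_le_mul_of_nonneg_left (by linarith) hn0.le
      linarith
  · intro Q hQ
    have hQg := sum_mul_sub_le_dTV hQ.1 hq hg0 hg1
    have hQε := hQ.2
    refine (iidExp_le_of_deviation hQ.1 hg0 hg1 (by exact_mod_cast hn0) (s := δ / 4)
      (by positivity) (fun x => ?_) (fun x hx => ?_)).trans hbound
    · dsimp only; split_ifs <;> norm_num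
    · dsimp only
      rw [if_pos, sub_self]
      have := (abs_lt.mp hx).2
      have h2 : n * (∑ a, Q a * g a + δ / 4) ≤ n * t :=
        mul_le_mul_of_nonneg_left (by linarith) hn0.le
      linarith

lemma iidExp_majorityTest {P : X → ℝ} (hP : IsDist P) {n : ℕ} (φ : (Fin n → X) → ℝ) :
    iidExp P (n + n + n) (majorityTest φ) = 3 * iidExp P n φ ^ 2 - 2 * iidExp P n φ ^ 3 := by
  have h3 : ∀ f g h : (Fin n → X) → ℝ, iidExp P (n + n + n) (fun x =>
      f (fun i => x (Fin.castAdd n (Fin.castAdd n i))) *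
        g (fun i => x (Fin.castAdd n (Fin.natAdd n i))) * h (fun i => x (Fin.natAdd (n + n) i)))
      = iidExp P n f * iidExp P n g * iidExp P n h := by
    intro f g h
    rw [← iidExp_append P n n f g, ← iidExp_append]
  have hab := h3 φ φ (fun _ => 1)
  have hac := h3 φ (fun _ => 1) φ
  have hbc := h3 (fun _ => 1) φ φ
  simp only [iidExp_const hP, mul_one, one_mul] at hab hac hbc
  unfold majorityTest
  simp only [iidExp_sub, iidExp_add, iidExp_const_mul, h3, hab, hac, hbc]
  ring

end Tests

section Minimax

variable {X : Type*} [Fintype X] {A B : Set (X → ℝ)} {n : ℕ}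

lemma errSum_nonneg (hA : ∀ P ∈ A, IsDist P) (hB : ∀ Q ∈ B, IsDist Q) {φ : (Fin n → X) → ℝ}
    (hφ : ∀ x, 0 ≤ φ x ∧ φ x ≤ 1) : 0 ≤ errSum A B n φ :=
  add_nonneg (Real.iSup_nonneg fun P => iidExp_nonneg (hA P P.2) fun x => (hφ x).1)
    (Real.iSup_nonneg fun Q => iidExp_nonneg (hB Q Q.2) fun x => sub_nonneg.2 (hφ x).2)

lemma eStar_le {a b : ℝ} (hA : ∀ P ∈ A, IsDist P) (hB : ∀ Q ∈ B, IsDist Q)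
    (hA0 : A.Nonempty) (hB0 : B.Nonempty) {φ : (Fin n → X) → ℝ}
    (hφ : ∀ x, 0 ≤ φ x ∧ φ x ≤ 1) (ha : ∀ P ∈ A, iidExp P n φ ≤ a)
    (hb : ∀ Q ∈ B, iidExp Q n (fun x => 1 - φ x) ≤ b) : eStar A B n ≤ a + b := by
  have := hA0.to_subtype
  have := hB0.to_subtype
  refine (ciInf_le ⟨0, ?_⟩
    (⟨φ, hφ⟩ : {φ : (Fin n → X) → ℝ // ∀ x, 0 ≤ φ x ∧ φ x ≤ 1})).trans ?_
  · rintro _ ⟨ψ, rfl⟩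
    exact errSum_nonneg hA hB ψ.2
  · exact add_le_add (ciSup_le fun P => ha P P.2) (ciSup_le fun Q => hb Q Q.2)

lemma exists_test_of_eStar_lt {r : ℝ} (hA : ∀ P ∈ A, IsDist P) (hB : ∀ Q ∈ B, IsDist Q)
    (h : eStar A B n < r) :
    ∃ (φ : (Fin n → X) → ℝ) (a b : ℝ), (∀ x, 0 ≤ φ x ∧ φ x ≤ 1) ∧
      (∀ P ∈ A, iidExp P n φ ≤ a) ∧ (∀ Q ∈ B, iidExp Q n (fun x => 1 - φ x) ≤ b) ∧
      a + b < r := by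
  have : Nonempty {φ : (Fin n → X) → ℝ // ∀ x, 0 ≤ φ x ∧ φ x ≤ 1} :=
    ⟨⟨fun _ => 0, fun _ => ⟨le_rfl, zero_le_one⟩⟩⟩
  obtain ⟨⟨φ, hφ⟩, hlt⟩ := exists_lt_of_ciInf_lt h
  refine ⟨φ, _, _, hφ, fun P hP => ?_, fun Q hQ => ?_, hlt⟩
  · refine le_ciSup (f := fun P : A => iidExp (P : X → ℝ) n φ) ⟨1, ?_⟩ ⟨P, hP⟩
    rintro _ ⟨R, rfl⟩
    exact iidExp_le_one (hA R R.2) fun x => (hφ x).2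
  · refine le_ciSup (f := fun Q : B => iidExp (Q : X → ℝ) n fun x => 1 - φ x) ⟨1, ?_⟩ ⟨Q, hQ⟩
    rintro _ ⟨R, rfl⟩
    exact iidExp_le_one (hB R R.2) fun x => sub_le_self _ (hφ x).1

lemma eStar_mono {A' B' : Set (X → ℝ)} (hA : ∀ P ∈ A', IsDist P) (hB : ∀ Q ∈ B', IsDist Q)
    (hA0 : A.Nonempty) (hB0 : B.Nonempty) (hAA' : A ⊆ A') (hBB' : B ⊆ B') (n : ℕ) :
    eStar A B n ≤ eStar A' B' n := by
  refine le_of_forall_gt fun r hr => ?_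
  obtain ⟨φ, a, b, hφ, ha, hb, hab⟩ := exists_test_of_eStar_lt hA hB hr
  exact (eStar_le (fun P hP => hA P (hAA' hP)) (fun Q hQ => hB Q (hBB' hQ)) hA0 hB0 hφ
    (fun P hP => ha P (hAA' hP)) (fun Q hQ => hb Q (hBB' hQ))).trans_lt hab

lemma nStar_le_of_eStar_le (h : eStar A B n ≤ 1 / 10) : nStar A B ≤ n :=
  sInf_le ⟨n, rfl, h⟩

lemma nStar_mono {A' B' : Set (X → ℝ)} (hA : ∀ P ∈ A', IsDist P) (hB : ∀ Q ∈ B', IsDist Q)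
    (hA0 : A.Nonempty) (hB0 : B.Nonempty) (hAA' : A ⊆ A') (hBB' : B ⊆ B') :
    nStar A B ≤ nStar A' B' := by
  refine le_sInf ?_
  rintro _ ⟨n, rfl, hn⟩
  exact nStar_le_of_eStar_le ((eStar_mono hA hB hA0 hB0 hAA' hBB' n).trans hn)

lemma exists_nStar_eq (h : eStar A B n ≤ 1 / 10) :
    ∃ m ≤ n, nStar A B = m ∧ eStar A B m ≤ 1 / 10 := by
  have hex : ∃ m, eStar A B m ≤ 1 / 10 := ⟨n, h⟩
  refine ⟨Nat.find hex, Nat.find_min' hex h, le_antisymm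
    (nStar_le_of_eStar_le (Nat.find_spec hex)) (le_sInf ?_), Nat.find_spec hex⟩
  rintro _ ⟨k, rfl, hk⟩
  exact_mod_cast Nat.find_min' hex hk

/-- If every element of the larger sets is `η`-close to `A`, `B` in total variation, `n * η` small, then
majority voting turns a test of `A` against `B` on `n` samples into one of the larger sets on `3 * n`. -/
lemma eStar_three_mul_le {A' B' : Set (X → ℝ)} (hA : ∀ P ∈ A, IsDist P) (hB : ∀ Q ∈ B, IsDist Q)
    (hA' : ∀ P ∈ A', IsDist P) (hB' : ∀ Q ∈ B', IsDist Q) (hA0 : A'.Nonempty)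
    (hB0 : B'.Nonempty) {η : ℝ} (hAA' : ∀ P ∈ A', ∃ P₀ ∈ A, dTV P P₀ ≤ η)
    (hBB' : ∀ Q ∈ B', ∃ Q₀ ∈ B, dTV Q Q₀ ≤ η) (hη : n * η ≤ 1 / 100)
    (h : eStar A B n ≤ 1 / 10) : eStar A' B' (n + n + n) ≤ 1 / 10 := by
  obtain ⟨φ, a, b, hφ, ha, hb, hab⟩ :=
    exists_test_of_eStar_lt (r := 11 / 100) hA hB (h.trans_lt (by norm_num))
  have hn : (0 : ℝ) ≤ n := n.cast_nonneg
  have hP1 : ∀ P ∈ A', iidExp P n φ ≤ a + 1 / 100 := by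
    intro P hP
    obtain ⟨P₀, hP₀, hd⟩ := hAA' P hP
    have h1 := iidExp_le_add_dTV (hA' P hP) (hA P₀ hP₀) n (fun x => (hφ x).1) fun x => (hφ x).2
    linarith [ha P₀ hP₀, mul_le_mul_of_nonneg_left hd hn]
  have hQ1 : ∀ Q ∈ B', iidExp Q n (fun x => 1 - φ x) ≤ b + 1 / 100 := by
    intro Q hQ
    obtain ⟨Q₀, hQ₀, hd⟩ := hBB' Q hQ
    have h1 := iidExp_le_add_dTV (hB' Q hQ) (hB Q₀ hQ₀) n (φ := fun x => 1 - φ x)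
      (fun x => sub_nonneg.2 (hφ x).2) fun x => sub_le_self _ (hφ x).1
    linarith [hb Q₀ hQ₀, mul_le_mul_of_nonneg_left hd hn]
  have hmaj : ∀ u v : ℝ, 0 ≤ u → u ≤ v → 3 * u ^ 2 - 2 * u ^ 3 ≤ 3 * v ^ 2 := fun u v hu huv => by
    have := pow_nonneg hu 3
    have := pow_le_pow_left₀ hu huv 2
    linarith
  have hPm : ∀ P ∈ A', iidExp P (n + n + n) (majorityTest φ) ≤ 3 * (a + 1 / 100) ^ 2 := by
    intro P hP
    rw [iidExp_majorityTest (hA' P hP)]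
    exact hmaj _ _ (iidExp_nonneg (hA' P hP) fun x => (hφ x).1) (hP1 P hP)
  have hQm : ∀ Q ∈ B', iidExp Q (n + n + n) (fun x => 1 - majorityTest φ x)
      ≤ 3 * (b + 1 / 100) ^ 2 := by
    intro Q hQ
    simp only [majorityTest_one_sub]
    rw [show (fun x => majorityTest (fun y => 1 - φ y) x) = majorityTest (fun y => 1 - φ y) from rfl,
      iidExp_majorityTest (hB' Q hQ)]
    exact hmaj _ _ (iidExp_nonneg (hB' Q hQ) fun x => sub_nonneg.2 (hφ x).2) (hQ1 Q hQ)
  have ha0 : 0 ≤ a + 1 / 100 := by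
    obtain ⟨P, hP⟩ := hA0
    exact (iidExp_nonneg (hA' P hP) fun x => (hφ x).1).trans (hP1 P hP)
  have hb0 : 0 ≤ b + 1 / 100 := by
    obtain ⟨Q, hQ⟩ := hB0
    exact (iidExp_nonneg (hB' Q hQ) fun x => sub_nonneg.2 (hφ x).2).trans (hQ1 Q hQ)
  refine (eStar_le hA' hB' hA0 hB0 (majorityTest_mem hφ) hPm hQm).trans ?_
  nlinarith [mul_nonneg ha0 hb0]

end Minimax

section Contamination

variable {X : Type*} [Fintype X]

lemma IsDist.mix {p r : X → ℝ} (hr : IsDist r) (hp : IsDist p) {t : ℝ} (h0 : 0 ≤ t) (h1 : t ≤ 1) :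
    IsDist fun x => (1 - t) * r x + t * p x := by
  refine ⟨fun x => add_nonneg (mul_nonneg (by linarith) (hr.1 x)) (mul_nonneg h0 (hp.1 x)), ?_⟩
  rw [Finset.sum_add_distrib, ← Finset.mul_sum, ← Finset.mul_sum, hr.2, hp.2]
  ring

lemma dTV_mix_left (p r : X → ℝ) {t : ℝ} (h1 : t ≤ 1) :
    dTV (fun x => (1 - t) * r x + t * p x) p = (1 - t) * dTV r p := by
  simp only [dTV, Finset.mul_sum]
  refine Finset.sum_congr rfl fun x _ => ?_
  rw [show (1 - t) * r x + t * p x - p x = (1 - t) * (r x - p x) by ring, abs_mul,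
    abs_of_nonneg (sub_nonneg.2 h1)]
  ring

lemma dTV_mix_right (p r : X → ℝ) {t : ℝ} (h0 : 0 ≤ t) :
    dTV r (fun x => (1 - t) * r x + t * p x) = t * dTV r p := by
  simp only [dTV, Finset.mul_sum]
  refine Finset.sum_congr rfl fun x _ => ?_
  rw [show r x - ((1 - t) * r x + t * p x) = t * (r x - p x) by ring, abs_mul, abs_of_nonneg h0]
  ring

/-- The properties shared by the TV, Huber and subtractive contamination models. -/
structure IsContamination (F : (X → ℝ) → ℝ → Set (X → ℝ)) : Prop where
  subset_PTV : ∀ {p}, IsDist p → ∀ ε, F p ε ⊆ PTV p ε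
  self_mem : ∀ {p}, IsDist p → ∀ {ε}, 0 ≤ ε → p ∈ F p ε
  mono : ∀ {p}, IsDist p → ∀ {ε ε'}, ε ≤ ε' → F p ε ⊆ F p ε'
  mix_mem : ∀ {p}, IsDist p → ∀ {ε t r}, 0 ≤ t → t ≤ 1 → r ∈ F p ε →
    (fun x => (1 - t) * r x + t * p x) ∈ F p ((1 - t) * ε)

lemma isContamination_PTV : IsContamination (PTV (X := X)) where
  subset_PTV _ _ := subset_rfl
  self_mem hp _ hε := ⟨hp, by simpa [dTV] using hε⟩
  mono _ _ _ h _ hr := ⟨hr.1, hr.2.trans h⟩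
  mix_mem hp ε t r h0 h1 hr := ⟨hr.1.mix hp h0 h1, by
    rw [dTV_mix_left _ _ h1]
    exact mul_le_mul_of_nonneg_left hr.2 (sub_nonneg.2 h1)⟩

lemma isContamination_PHub : IsContamination (PHub (X := X)) where
  subset_PTV {p} hp ε r hr := by
    refine ⟨hr.1, ?_⟩
    rw [dTV_comm, dTV_eq_sum_indicator hp hr.1, ← Finset.sum_sub_distrib]
    have hε : 0 ≤ ε := by
      have := Finset.sum_le_sum fun x (_ : x ∈ Finset.univ) => hr.2 x
      rw [← Finset.mul_sum, hp.2, hr.1.2] at this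
      linarith
    calc _ ≤ ∑ x, ε * p x := Finset.sum_le_sum fun x _ => by
          have := hr.2 x
          split_ifs
          · linarith
          · simpa using mul_nonneg hε (hp.1 x)
      _ = ε := by rw [← Finset.mul_sum, hp.2, mul_one]
  self_mem hp _ hε := ⟨hp, fun x => by nlinarith [hp.1 x]⟩
  mono hp _ _ h _ hr := ⟨hr.1, fun x =>
    (mul_le_mul_of_nonneg_right (by linarith) (hp.1 x)).trans (hr.2 x)⟩
  mix_mem hp ε t r h0 h1 hr := ⟨hr.1.mix hp h0 h1, fun x => by
    linarith [mul_le_mul_of_nonneg_left (hr.2 x) (sub_nonneg.2 h1)]⟩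

lemma isContamination_PSub : IsContamination (PSub (X := X)) where
  subset_PTV {p} hp ε r hr := by
    refine ⟨hr.1, ?_⟩
    rw [dTV_eq_sum_indicator hr.1 hp, ← Finset.sum_sub_distrib]
    have hε : 0 ≤ ε := by
      have := Finset.sum_le_sum fun x (_ : x ∈ Finset.univ) => hr.2 x
      rw [← Finset.mul_sum, hp.2, hr.1.2] at this
      linarith
    calc _ ≤ ∑ x, ε * p x := Finset.sum_le_sum fun x _ => by
          have := hr.2 x
          split_ifs
          · linarith
          · simpa using mul_nonneg hε (hp.1 x)
      _ = ε := by rw [← Finset.mul_sum, hp.2, mul_one]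
  self_mem hp _ hε := ⟨hp, fun x => by nlinarith [hp.1 x]⟩
  mono hp _ _ h _ hr := ⟨hr.1, fun x =>
    (hr.2 x).trans (mul_le_mul_of_nonneg_right (by linarith) (hp.1 x))⟩
  mix_mem hp ε t r h0 h1 hr := ⟨hr.1.mix hp h0 h1, fun x => by
    linarith [mul_le_mul_of_nonneg_left (hr.2 x) (sub_nonneg.2 h1)]⟩

namespace IsContamination

variable {F : (X → ℝ) → ℝ → Set (X → ℝ)} {p q : X → ℝ} {ε₀ ε : ℝ}

lemma isDist (hF : IsContamination F) (hp : IsDist p) : ∀ r ∈ F p ε, IsDist r :=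
  fun _ hr => (hF.subset_PTV hp ε hr).1

lemma exists_dTV_le (hF : IsContamination F) (hp : IsDist p) (h0 : 0 < ε₀) (h : ε₀ ≤ ε) :
    ∀ r ∈ F p ε, ∃ r₀ ∈ F p ε₀, dTV r r₀ ≤ ε - ε₀ := by
  intro r hr
  have hε : 0 < ε := h0.trans_le h
  have ht0 : 0 ≤ (ε - ε₀) / ε := div_nonneg (by linarith) hε.le
  have ht1 : (ε - ε₀) / ε ≤ 1 := by rw [div_le_one hε]; linarith
  have hmem := hF.mix_mem hp ht0 ht1 hr
  rw [show (1 - (ε - ε₀) / ε) * ε = ε₀ by field_simp; ring] at hmem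
  refine ⟨_, hmem, ?_⟩
  rw [dTV_mix_right _ _ ht0]
  calc (ε - ε₀) / ε * dTV r p ≤ (ε - ε₀) / ε * ε :=
        mul_le_mul_of_nonneg_left (hF.subset_PTV hp ε hr).2 ht0
    _ = ε - ε₀ := by field_simp

theorem nStar_stable (hF : IsContamination F) (hp : IsDist p) (hq : IsDist q)
    (hpq : 0 < dTV p q) (h0 : 0 < ε₀) (h0' : ε₀ ≤ dTV p q / 4) (h : ε₀ ≤ ε)
    (h' : ε ≤ ε₀ + 1 / 10000 * ε₀ ^ 2) :
    nStar (F p ε₀) (F q ε₀) ≤ nStar (F p ε) (F q ε) ∧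
      nStar (F p ε) (F q ε) ≤ ENNReal.ofReal 3 * nStar (F p ε₀) (F q ε₀) := by
  have hne : ∀ {r : X → ℝ} {η : ℝ}, IsDist r → ε₀ ≤ η → (F r η).Nonempty :=
    fun hr hη => ⟨_, hF.self_mem hr (h0.le.trans hη)⟩
  refine ⟨nStar_mono (hF.isDist hp) (hF.isDist hq) (hne hp le_rfl) (hne hq le_rfl) (hF.mono hp h)
    (hF.mono hq h), ?_⟩
  obtain ⟨φ, hφ, hφp, hφq⟩ := exists_robust_test hp hq hpq h0'
    (Nat.le_ceil (320 / dTV p q ^ 2))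
  have hN : eStar (F p ε₀) (F q ε₀) ⌈320 / dTV p q ^ 2⌉₊ ≤ 1 / 10 :=
    (eStar_le (hF.isDist hp) (hF.isDist hq) (hne hp le_rfl) (hne hq le_rfl) hφ
      (fun P hP => hφp P (hF.subset_PTV hp _ hP))
      (fun Q hQ => hφq Q (hF.subset_PTV hq _ hQ))).trans (by norm_num)
  obtain ⟨m, hmN, hm, hme⟩ := exists_nStar_eq hN
  have hm_le : m * dTV p q ^ 2 ≤ 321 := by
    have h1 : (m : ℝ) ≤ 320 / dTV p q ^ 2 + 1 :=
      (Nat.cast_le.2 hmN).trans (Nat.ceil_lt_add_one (by positivity)).le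
    have h2 := mul_le_mul_of_nonneg_right h1 (sq_nonneg (dTV p q))
    rw [add_mul, div_mul_cancel₀ _ (by positivity)] at h2
    have h3 : dTV p q ^ 2 ≤ 1 := pow_le_one₀ hpq.le (dTV_le_one hp hq)
    linarith
  have hη : m * (ε - ε₀) ≤ 1 / 100 := by
    have h1 : ε₀ ^ 2 ≤ dTV p q ^ 2 / 16 := by
      have := pow_le_pow_left₀ h0.le h0' 2
      linarith
    have h2 : m * (ε - ε₀) ≤ m * (1 / 10000 * (dTV p q ^ 2 / 16)) :=
      mul_le_mul_of_nonneg_left (by linarith) m.cast_nonneg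
    linarith
  have := nStar_le_of_eStar_le (eStar_three_mul_le (hF.isDist hp) (hF.isDist hq) (hF.isDist hp)
    (hF.isDist hq) (hne hp h) (hne hq h) (hF.exists_dTV_le hp h0 h) (hF.exists_dTV_le hq h0 h)
    hη hme)
  refine this.trans_eq ?_
  rw [hm, ENNReal.ofReal_ofNat]
  push_cast
  ring

end IsContamination

end Contamination

/-- Stability of the sample complexity under `O(ε₀²)` perturbations of the contamination level,
in the TV, Huber and subtractive models. -/
theorem no_jumps_for_eps_squared_perturbations :
    ∃ c C : ℝ, 0 < c ∧ 1 ≤ C ∧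
      ∀ (X : Type) [Fintype X] [Nonempty X] (p q : X → ℝ),
        IsDist p → IsDist q → 0 < dTV p q →
        ∀ ε₀ ε : ℝ, 0 < ε₀ → ε₀ ≤ dTV p q / 4 → ε₀ ≤ ε → ε ≤ ε₀ + c * ε₀ ^ 2 →
          (nStar (PTV p ε₀) (PTV q ε₀) ≤ nStar (PTV p ε) (PTV q ε) ∧
            nStar (PTV p ε) (PTV q ε) ≤
              ENNReal.ofReal C * nStar (PTV p ε₀) (PTV q ε₀)) ∧
          (nStar (PHub p ε₀) (PHub q ε₀) ≤ nStar (PHub p ε) (PHub q ε) ∧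
            nStar (PHub p ε) (PHub q ε) ≤
              ENNReal.ofReal C * nStar (PHub p ε₀) (PHub q ε₀)) ∧
          (nStar (PSub p ε₀) (PSub q ε₀) ≤ nStar (PSub p ε) (PSub q ε) ∧
            nStar (PSub p ε) (PSub q ε) ≤
              ENNReal.ofReal C * nStar (PSub p ε₀) (PSub q ε₀)) := by
  refine ⟨1 / 10000, 3, by norm_num, by norm_num, fun X _ _ p q hp hq hpq ε₀ ε h0 h0' h h' => ?_⟩
  exact ⟨isContamination_PTV.nStar_stable hp hq hpq h0 h0' h h',
    isContamination_PHub.nStar_stable hp hq hpq h0 h0' h h',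
    isContamination_PSub.nStar_stable hp hq hpq h0 h0' h h'⟩

end
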